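/- (Refined L¹-contraction.) For every t > 0 and all x₁ < x₂: ∫_{x₁}^{x₂} |u₂⁺(x,t) − u₁⁺(x,t)| dx ≤ ∫_{x₁ − t·f'(M(x₁,t))}^{x₂ − t·f'(m(x₂,t))} |φ₂(x) − φ₁(x)| dx, where M(x,t) := max{u₁⁻(x,t), u₂⁻(x,t)} and m(x,t) := min{u₁⁺(x,t), u₂⁺(x,t)}. -/

import Mathlib

open MeasureTheory Filter Set

noncomputable def eFun (f φ : ℝ → ℝ) (u x t : ℝ) : ℝ :=
  t * (∫ s in (0:ℝ)..u, deriv (deriv f) s * (φ (x - t * deriv f s) - s))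

def maxSet (f φ : ℝ → ℝ) (x t : ℝ) : Set ℝ :=
  {w : ℝ | ∀ v : ℝ, eFun f φ v x t ≤ eFun f φ w x t}

noncomputable def uPlus (f φ : ℝ → ℝ) (x t : ℝ) : ℝ := sInf (maxSet f φ x t)

noncomputable def uMinus (f φ : ℝ → ℝ) (x t : ℝ) : ℝ := sSup (maxSet f φ x t)

/-- The Legendre transform of `f`, evaluated at the slope of `f` at `u`. -/
noncomputable def legendre (f : ℝ → ℝ) (u : ℝ) : ℝ := u * deriv f u - f u

/-- The Lax–Oleinik functional minimized by the entropy solution; the data is integrated from the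
base point `a`. -/
noncomputable def action (f φ : ℝ → ℝ) (a t x u : ℝ) : ℝ :=
  (∫ s in a..(x - t * deriv f u), φ s) + t * legendre f u

lemma intervalIntegrable_of_bounded {φ : ℝ → ℝ} {M : ℝ} (hm : Measurable φ)
    (hb : ∀ x, |φ x| ≤ M) (a b : ℝ) : IntervalIntegrable φ volume a b :=
  (intervalIntegrable_const (c := M)).mono_fun hm.aestronglyMeasurable
    (Eventually.of_forall fun x => by
      simpa using (hb x).trans (le_abs_self M))

lemma strictMono_deriv_of_null_zeros {f : ℝ → ℝ} (hf : ContDiff ℝ 2 f)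
    (hconv : ∀ u, 0 ≤ deriv (deriv f) u) (hdeg : volume {u | deriv (deriv f) u = 0} = 0) :
    StrictMono (deriv f) := by
  have hd : Differentiable ℝ (deriv f) :=
    (hf.deriv' (n := 1)).differentiable one_ne_zero
  have hmono := monotone_of_deriv_nonneg hd hconv
  intro p q hpq
  refine (hmono hpq.le).lt_of_ne fun heq => ?_
  have hsub : Ioo p q ⊆ {u | deriv (deriv f) u = 0} := by
    intro u hu
    have hconst : deriv f =ᶠ[nhds u] fun _ => deriv f p := by
      filter_upwards [Ioo_mem_nhds hu.1 hu.2] with v hv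
      exact le_antisymm ((hmono hv.2.le).trans heq.ge) (hmono hv.1.le)
    simpa using hconst.deriv_eq
  have h0 := measure_mono_null hsub hdeg
  rw [Real.volume_Ioo, ENNReal.ofReal_eq_zero] at h0
  linarith

section StrictlyConvexFlux

variable {f : ℝ → ℝ} (hd : Differentiable ℝ f) (hc : Continuous (deriv f))
  (hmono : StrictMono (deriv f))

include hd hmono in
lemma legendre_lt {v w : ℝ} (hne : w ≠ v) :
    legendre f v + v * (deriv f w - deriv f v) < legendre f w := by
  have hconv : StrictConvexOn ℝ univ f := hmono.strictConvexOn_univ_of_deriv hd.continuous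
  unfold legendre
  rcases lt_or_gt_of_ne hne with h | h
  · have hs := hconv.deriv_lt_slope (mem_univ w) (mem_univ v) h (hd w)
    rw [slope_def_field, lt_div_iff₀ (sub_pos.2 h)] at hs
    linarith
  · have hs := hconv.slope_lt_deriv (mem_univ v) (mem_univ w) h (hd w)
    rw [slope_def_field, div_lt_iff₀ (sub_pos.2 h)] at hs
    linarith

include hd hmono in
lemma legendre_add_lt {p q r s : ℝ} (hsum : deriv f p + deriv f s = deriv f q + deriv f r)
    (hpq : deriv f p < deriv f q) (hpr : deriv f p < deriv f r) :
    legendre f q + legendre f r < legendre f p + legendre f s := by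
  wlog hqr : q ≤ r generalizing q r
  · linarith [this (by linarith) hpr hpq (le_of_not_ge hqr)]
  have h1 := legendre_lt hd hmono (v := q) (w := p) (by rintro rfl; exact hpq.false)
  have h2 := legendre_lt hd hmono (v := r) (w := s) (by rintro rfl; linarith)
  have h3 : deriv f s - deriv f r = deriv f q - deriv f p := by linarith
  rw [h3] at h2
  nlinarith [mul_nonneg (sub_nonneg.2 hqr) (sub_nonneg.2 hpq.le)]

include hd hc hmono in
/-- Uncrossing two crossing characteristics strictly lowers the total cost. -/
lemma exists_uncrossing {t x x' w w' : ℝ} (ht : 0 < t) (hx : x < x')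
    (hy : x' - t * deriv f w' < x - t * deriv f w) :
    ∃ b c, x - t * deriv f b = x' - t * deriv f w' ∧ x' - t * deriv f c = x - t * deriv f w ∧
      legendre f b + legendre f c < legendre f w + legendre f w' := by
  have hδ : 0 < (x' - x) / t := div_pos (sub_pos.2 hx) ht
  have hδt : t * ((x' - x) / t) = x' - x := mul_div_cancel₀ _ ht.ne'
  have hlt : deriv f w + (x' - x) / t < deriv f w' := by
    by_contra! hle
    have := mul_le_mul_of_nonneg_left hle ht.le
    rw [mul_add, hδt] at this
    linarith
  obtain ⟨b, hb⟩ := mem_range_of_exists_le_of_exists_ge hc (c := deriv f w' - (x' - x) / t)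
    ⟨w, by linarith⟩ ⟨w', by linarith⟩
  obtain ⟨c, hc'⟩ := mem_range_of_exists_le_of_exists_ge hc (c := deriv f w + (x' - x) / t)
    ⟨w, by linarith⟩ ⟨w', by linarith⟩
  refine ⟨b, c, ?_, ?_, legendre_add_lt hd hmono ?_ ?_ ?_⟩
  · rw [hb, mul_sub, hδt]; ring
  · rw [hc', mul_add, hδt]; ring
  all_goals linarith

include hd hc hmono in
/-- Minimizing characteristics do not cross. -/
lemma foot_le_foot {φ : ℝ → ℝ} {a t x x' w w' : ℝ} (ht : 0 < t) (hx : x < x')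
    (hw : ∀ v, action f φ a t x w ≤ action f φ a t x v)
    (hw' : ∀ v, action f φ a t x' w' ≤ action f φ a t x' v) :
    x - t * deriv f w ≤ x' - t * deriv f w' := by
  by_contra! hy
  obtain ⟨b, c, hb, hc', hlt⟩ := exists_uncrossing hd hc hmono ht hx hy
  have h1 := hw b
  have h2 := hw' c
  unfold action at h1 h2
  rw [hb] at h1
  rw [hc'] at h2
  have := mul_lt_mul_of_pos_left hlt ht
  linarith

include hd hc hmono in
/-- If `ψ ≥ φ` beyond the base point `a`, the difference of the two value functions is monotone
at points whose characteristics for `φ` start beyond `a`. -/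
lemma action_add_le_action_add {φ ψ : ℝ → ℝ} {a t x x' w w' u u' : ℝ} (ht : 0 < t) (hx : x < x')
    (hφ : ∀ p q, IntervalIntegrable φ volume p q) (hψ : ∀ p q, IntervalIntegrable ψ volume p q)
    (hle : ∀ y, a ≤ y → φ y ≤ ψ y)
    (ha : a ≤ x - t * deriv f w)
    (hw' : ∀ v, action f φ a t x' w' ≤ action f φ a t x' v)
    (hu : ∀ v, action f ψ a t x u ≤ action f ψ a t x v) :
    action f ψ a t x u + action f φ a t x' w' ≤ action f ψ a t x' u' + action f φ a t x w := by
  rcases le_or_gt (x - t * deriv f w) (x' - t * deriv f u') with hy | hy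
  · have h1 := hu w
    have h2 := hw' u'
    have h3 : ∫ s in (x - t * deriv f w)..(x' - t * deriv f u'), φ s ≤
        ∫ s in (x - t * deriv f w)..(x' - t * deriv f u'), ψ s :=
      intervalIntegral.integral_mono_on hy (hφ _ _) (hψ _ _) fun y hy => hle y (ha.trans hy.1)
    rw [← intervalIntegral.integral_interval_sub_left (hφ a _) (hφ a _),
      ← intervalIntegral.integral_interval_sub_left (hψ a _) (hψ a _)] at h3
    unfold action at h1 h2 ⊢
    linarith
  · obtain ⟨b, c, hb, hc', hlt⟩ := exists_uncrossing hd hc hmono ht hx hy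
    have h1 := hu b
    have h2 := hw' c
    have h3 := mul_lt_mul_of_pos_left hlt ht
    unfold action at h1 h2 ⊢
    rw [hb] at h1
    rw [hc'] at h2
    linarith

include hd hc hmono in
/-- Where the value function is differentiable, its derivative is the minimizer. -/
lemma eq_of_hasDerivAt_of_le_action {φ V : ℝ → ℝ} {a t x w d : ℝ} (ht : 0 < t)
    (hV : ∀ x' v, V x' ≤ action f φ a t x' v) (hVx : V x = action f φ a t x w)
    (hder : HasDerivAt V d x) : d = w := by
  set X : ℝ → ℝ := fun v => x + t * (deriv f v - deriv f w) with hX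
  have hXw : X w = x := by simp [hX]
  have hbound : ∀ v, v ≠ w → V (X v) - V x ≤ v * (X v - x) := by
    intro v hv
    have h1 := hV (X v) v
    have h2 := mul_lt_mul_of_pos_left (legendre_lt hd hmono hv.symm) ht
    have h3 : X v - t * deriv f v = x - t * deriv f w := by simp only [hX]; ring
    unfold action at h1 hVx
    rw [h3] at h1
    have h4 : v * (X v - x) = - (t * (v * (deriv f w - deriv f v))) := by simp only [hX]; ring
    rw [h4]
    linarith
  have hXt : Tendsto X (nhds w) (nhds x) := by
    have : Continuous X := by fun_prop
    simpa [hXw] using this.tendsto w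
  have hXlt : ∀ {v}, v < w → X v < x := fun {v} h => by
    have := mul_neg_of_pos_of_neg ht (sub_neg.2 (hmono h))
    simp only [hX]; linarith
  have hXgt : ∀ {v}, w < v → x < X v := fun {v} h => by
    have := mul_pos ht (sub_pos.2 (hmono h))
    simp only [hX]; linarith
  have hslope := hasDerivAt_iff_tendsto_slope.1 hder
  apply le_antisymm
  · have hcomp : Tendsto (fun v => slope V x (X v)) (nhdsWithin w (Ioi w)) (nhds d) :=
      hslope.comp (tendsto_nhdsWithin_iff.2 ⟨hXt.mono_left nhdsWithin_le_nhds,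
        eventually_nhdsWithin_of_forall fun v hv => (hXgt hv).ne'⟩)
    refine le_of_tendsto_of_tendsto hcomp (tendsto_id.mono_left nhdsWithin_le_nhds)
      (eventually_nhdsWithin_of_forall fun v hv => ?_)
    simp only [slope_def_field, id]
    rw [div_le_iff₀ (sub_pos.2 (hXgt hv))]
    exact hbound v (ne_of_gt hv)
  · have hcomp : Tendsto (fun v => slope V x (X v)) (nhdsWithin w (Iio w)) (nhds d) :=
      hslope.comp (tendsto_nhdsWithin_iff.2 ⟨hXt.mono_left nhdsWithin_le_nhds,
        eventually_nhdsWithin_of_forall fun v hv => (hXlt hv).ne⟩)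
    refine le_of_tendsto_of_tendsto (tendsto_id.mono_left nhdsWithin_le_nhds) hcomp
      (eventually_nhdsWithin_of_forall fun v hv => ?_)
    simp only [slope_def_field, id]
    rw [le_div_iff_of_neg (sub_neg.2 (hXlt hv))]
    exact hbound v (ne_of_lt hv)

section BoundedData

variable {φ : ℝ → ℝ} {M : ℝ} (hm : Measurable φ) (hb : ∀ x, |φ x| ≤ M)

include hm hb in
lemma abs_action_sub_action_sub_le (a t x x' v w : ℝ) :
    |action f φ a t x v - action f φ a t x' w - t * (legendre f v - legendre f w)| ≤
      M * |x - t * deriv f v - (x' - t * deriv f w)| := by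
  have hi := intervalIntegrable_of_bounded hm hb
  have h := intervalIntegral.norm_integral_le_of_norm_le_const (f := φ) (C := M)
    (a := x' - t * deriv f w) (b := x - t * deriv f v) fun y _ => hb y
  rw [← intervalIntegral.integral_interval_sub_left (hi a _) (hi a _), Real.norm_eq_abs] at h
  unfold action
  convert h using 2
  ring

include hd hmono hm hb in
lemma action_lt_action_of_bound_lt {a t x v : ℝ} (ht : 0 < t) (hv : M < v) :
    action f φ a t x M < action f φ a t x v := by
  have h1 := (abs_le.1 (abs_action_sub_action_sub_le (f := f) hm hb a t x x v M)).1
  have h2 := mul_lt_mul_of_pos_left (legendre_lt hd hmono hv.ne') ht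
  have h3 : x - t * deriv f v - (x - t * deriv f M) = - (t * (deriv f v - deriv f M)) := by ring
  rw [h3, abs_neg, abs_of_pos (mul_pos ht (sub_pos.2 (hmono hv)))] at h1
  linarith

include hd hmono hm hb in
lemma action_lt_action_of_lt_neg_bound {a t x v : ℝ} (ht : 0 < t) (hv : v < -M) :
    action f φ a t x (-M) < action f φ a t x v := by
  have h1 := (abs_le.1 (abs_action_sub_action_sub_le (f := f) hm hb a t x x v (-M))).1
  have h2 := mul_lt_mul_of_pos_left (legendre_lt hd hmono hv.ne) ht
  have h3 : x - t * deriv f v - (x - t * deriv f (-M)) = t * (deriv f (-M) - deriv f v) := by ring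
  rw [h3, abs_of_pos (mul_pos ht (sub_pos.2 (hmono hv)))] at h1
  linarith

include hd hmono hm hb in
lemma abs_le_of_forall_action_le {a t x w : ℝ} (ht : 0 < t)
    (hw : ∀ v, action f φ a t x w ≤ action f φ a t x v) : |w| ≤ M :=
  abs_le.2 ⟨not_lt.1 fun h =>
      (hw (-M)).not_gt (action_lt_action_of_lt_neg_bound hd hmono hm hb ht h),
    not_lt.1 fun h => (hw M).not_gt (action_lt_action_of_bound_lt hd hmono hm hb ht h)⟩

include hd hc hm hb in
lemma continuous_action (a t x : ℝ) : Continuous (action f φ a t x) := by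
  have h1 := intervalIntegral.continuous_primitive (intervalIntegrable_of_bounded hm hb) a
  have h2 := hd.continuous
  unfold action legendre
  fun_prop

include hd hc hmono hm hb in
lemma exists_forall_action_le {a t x : ℝ} (ht : 0 < t) :
    ∃ w, ∀ v, action f φ a t x w ≤ action f φ a t x v := by
  have h0 : 0 ≤ M := (abs_nonneg _).trans (hb 0)
  obtain ⟨w, hw, hmin⟩ := isCompact_Icc.exists_isMinOn (nonempty_Icc.2 (neg_le_self h0))
    (continuous_action hd hc hm hb a t x).continuousOn
  refine ⟨w, fun v => ?_⟩
  rcases lt_or_ge v (-M) with hv | hv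
  · exact (hmin (left_mem_Icc.2 (neg_le_self h0))).trans
      (action_lt_action_of_lt_neg_bound hd hmono hm hb ht hv).le
  rcases le_or_gt v M with hv' | hv'
  · exact hmin ⟨hv, hv'⟩
  · exact (hmin (right_mem_Icc.2 (neg_le_self h0))).trans
      (action_lt_action_of_bound_lt hd hmono hm hb ht hv').le

include hm hb in
lemma lipschitzWith_of_eq_action {V u : ℝ → ℝ} {a t : ℝ}
    (hV : ∀ x v, V x ≤ action f φ a t x v) (hVu : ∀ x, V x = action f φ a t x (u x)) :
    LipschitzWith M.toNNReal V := by
  have h0 : 0 ≤ M := (abs_nonneg _).trans (hb 0)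
  refine LipschitzWith.of_le_add_mul _ fun x y => ?_
  have h1 := hV x (u y)
  have h2 := (abs_le.1 (abs_action_sub_action_sub_le (f := f) hm hb a t x y (u y) (u y))).2
  rw [← hVu y] at h2
  have h3 : x - t * deriv f (u y) - (y - t * deriv f (u y)) = x - y := by ring
  rw [h3] at h2
  rw [Real.coe_toNNReal _ h0, Real.dist_eq]
  linarith

end BoundedData

end StrictlyConvexFlux

section EntropySolution

variable {f : ℝ → ℝ} (hf : ContDiff ℝ 2 f) (hconv : ∀ u, 0 ≤ deriv (deriv f) u)
  (hdeg : volume {u | deriv (deriv f) u = 0} = 0)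
  {φ : ℝ → ℝ} {M : ℝ} (hm : Measurable φ) (hb : ∀ x, |φ x| ≤ M)

include hf hconv hm hb in
lemma eFun_eq_action_sub {a t x : ℝ} (ht : 0 < t) (u : ℝ) :
    eFun f φ u x t = action f φ a t x 0 - action f φ a t x u := by
  have hd : Differentiable ℝ f := hf.differentiable two_ne_zero
  have hf' : ContDiff ℝ 1 (deriv f) := hf.deriv'
  have hd' : Differentiable ℝ (deriv f) := hf'.differentiable one_ne_zero
  have hc'' : Continuous (deriv (deriv f)) := hf'.continuous_deriv le_rfl
  have hc' := hd'.continuous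
  have hi := intervalIntegrable_of_bounded hm hb
  have hcomp := intervalIntegrable_of_bounded (φ := fun s => φ (x - t * deriv f s))
    (hm.comp (by fun_prop : Continuous fun s => x - t * deriv f s).measurable)
    (fun s => hb _) 0 u
  have hsubst := intervalIntegral.integral_deriv_smul_comp_of_deriv_nonpos (a := 0) (b := u)
    (f := fun s => x - t * deriv f s) (f' := fun s => -(t * deriv (deriv f) s)) (g := φ)
    (by fun_prop)
    (fun s _ => ((hd' s).hasDerivAt.const_mul t).const_sub x)
    (fun s _ => neg_nonpos.2 (mul_nonneg ht.le (hconv s)))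
  have hparts : ∫ s in (0:ℝ)..u, deriv (deriv f) s * s = legendre f u - legendre f 0 := by
    refine intervalIntegral.integral_eq_sub_of_hasDerivAt (fun s _ => ?_)
      ((by fun_prop : Continuous fun s => deriv (deriv f) s * s).intervalIntegrable _ _)
    have := ((hasDerivAt_id s).mul (hd' s).hasDerivAt).sub (hd s).hasDerivAt
    refine this.congr_deriv ?_
    simp only [id]
    ring
  have hsplit : ∫ s in (0:ℝ)..u, deriv (deriv f) s * (φ (x - t * deriv f s) - s) =
      (∫ s in (0:ℝ)..u, deriv (deriv f) s * φ (x - t * deriv f s)) -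
        ∫ s in (0:ℝ)..u, deriv (deriv f) s * s := by
    simp only [mul_sub]
    exact intervalIntegral.integral_sub (hcomp.continuousOn_mul hc''.continuousOn)
      ((by fun_prop : Continuous fun s => deriv (deriv f) s * s).intervalIntegrable _ _)
  have hpull : ∫ s in (0:ℝ)..u, -(t * deriv (deriv f) s) * (φ ∘ fun s => x - t * deriv f s) s =
      -(t * ∫ s in (0:ℝ)..u, deriv (deriv f) s * φ (x - t * deriv f s)) := by
    rw [← intervalIntegral.integral_const_mul, ← intervalIntegral.integral_neg]
    simp only [Function.comp, neg_mul, mul_assoc]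
  simp only [smul_eq_mul] at hsubst
  rw [hpull, ← intervalIntegral.integral_interval_sub_left (hi a _) (hi a _)] at hsubst
  unfold eFun action
  rw [hsplit, hparts]
  linarith

include hf hconv hm hb in
lemma mem_maxSet_iff {a t x w : ℝ} (ht : 0 < t) :
    w ∈ maxSet f φ x t ↔ ∀ v, action f φ a t x w ≤ action f φ a t x v := by
  simp only [maxSet, mem_ofPred_eq, eFun_eq_action_sub hf hconv hm hb (a := a) ht]
  exact forall_congr' fun v => sub_le_sub_iff_left _

include hf hconv hdeg hm hb in
lemma maxSet_subset_Icc {t : ℝ} (x : ℝ) (ht : 0 < t) : maxSet f φ x t ⊆ Icc (-M) M := fun _ hw =>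
  abs_le.1 (abs_le_of_forall_action_le (hf.differentiable two_ne_zero)
    (strictMono_deriv_of_null_zeros hf hconv hdeg) hm hb ht
    ((mem_maxSet_iff hf hconv hm hb (a := 0) ht).1 hw))

include hf hconv hdeg hm hb in
lemma uPlus_mem_maxSet {t : ℝ} (x : ℝ) (ht : 0 < t) : uPlus f φ x t ∈ maxSet f φ x t := by
  have hd : Differentiable ℝ f := hf.differentiable two_ne_zero
  have hc : Continuous (deriv f) := hf.continuous_deriv one_le_two
  have hmono := strictMono_deriv_of_null_zeros hf hconv hdeg
  have heq : maxSet f φ x t = {w | ∀ v, action f φ 0 t x w ≤ action f φ 0 t x v} :=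
    Set.ext fun _ => mem_maxSet_iff hf hconv hm hb ht
  have hclosed : IsClosed (maxSet f φ x t) := by
    rw [heq, ofPred_forall]
    exact isClosed_iInter fun v =>
      isClosed_le (continuous_action hd hc hm hb 0 t x) continuous_const
  obtain ⟨w, hw⟩ := exists_forall_action_le hd hc hmono hm hb (a := 0) (x := x) ht
  exact hclosed.csInf_mem ⟨w, heq ▸ hw⟩
    (bddBelow_Icc.mono (maxSet_subset_Icc hf hconv hdeg hm hb x ht))

include hf hconv hdeg hm hb in
lemma uPlus_le_uMinus {t : ℝ} (x : ℝ) (ht : 0 < t) : uPlus f φ x t ≤ uMinus f φ x t :=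
  le_csSup (bddAbove_Icc.mono (maxSet_subset_Icc hf hconv hdeg hm hb x ht))
    (uPlus_mem_maxSet hf hconv hdeg hm hb x ht)

end EntropySolution

/-- refined L¹-contraction. -/
theorem stmt7_refined_L1_contraction
    (f φ₁ φ₂ : ℝ → ℝ) (M₁ M₂ : ℝ)
    (hf : ContDiff ℝ 2 f)
    (hconv : ∀ u : ℝ, 0 ≤ deriv (deriv f) u)
    (hdeg : volume {u : ℝ | deriv (deriv f) u = 0} = 0)
    (hφ₁meas : Measurable φ₁)
    (hφ₁bdd : ∀ x : ℝ, |φ₁ x| ≤ M₁)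
    (hφ₂meas : Measurable φ₂)
    (hφ₂bdd : ∀ x : ℝ, |φ₂ x| ≤ M₂) :
    ∀ t : ℝ, 0 < t → ∀ x₁ x₂ : ℝ, x₁ < x₂ →
      (∫ x in x₁..x₂, |uPlus f φ₂ x t - uPlus f φ₁ x t|)
        ≤ ∫ x in
            (x₁ - t * deriv f (max (uMinus f φ₁ x₁ t) (uMinus f φ₂ x₁ t)))..(x₂ -
              t * deriv f (min (uPlus f φ₁ x₂ t) (uPlus f φ₂ x₂ t))),
            |φ₂ x - φ₁ x| := by
  intro t ht x₁ x₂ hx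
  have hd : Differentiable ℝ f := hf.differentiable two_ne_zero
  have hc : Continuous (deriv f) := hf.continuous_deriv one_le_two
  have hmono := strictMono_deriv_of_null_zeros hf hconv hdeg
  set a := x₁ - t * deriv f (max (uMinus f φ₁ x₁ t) (uMinus f φ₂ x₁ t))
  set b := x₂ - t * deriv f (min (uPlus f φ₁ x₂ t) (uPlus f φ₂ x₂ t))
  -- comparison data: above both data beyond `a`, below both data before `a`
  set ψ : ℝ → ℝ := (Iio a).piecewise (fun y => min (φ₁ y) (φ₂ y)) fun y => max (φ₁ y) (φ₂ y)
    with hψ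
  have hψmeas : Measurable ψ :=
    (hφ₁meas.min hφ₂meas).piecewise measurableSet_Iio (hφ₁meas.max hφ₂meas)
  have hψbdd : ∀ x, |ψ x| ≤ max M₁ M₂ := by
    intro x
    have h1 := (hφ₁bdd x).trans (le_max_left M₁ M₂)
    have h2 := (hφ₂bdd x).trans (le_max_right M₁ M₂)
    by_cases hxa : x ∈ Iio a
    · rw [hψ, piecewise_eq_of_mem _ _ _ hxa]
      rcases min_choice (φ₁ x) (φ₂ x) with h | h <;> rw [h] <;> assumption
    · rw [hψ, piecewise_eq_of_notMem _ _ _ hxa]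
      rcases max_choice (φ₁ x) (φ₂ x) with h | h <;> rw [h] <;> assumption
  have hψ_lt : ∀ y, y < a → ψ y = min (φ₁ y) (φ₂ y) := fun y hy => piecewise_eq_of_mem _ _ _ hy
  have hψ_ge : ∀ y, a ≤ y → ψ y = max (φ₁ y) (φ₂ y) := fun y hy =>
    piecewise_eq_of_notMem _ _ _ (not_lt.2 hy)
  have hψi := intervalIntegrable_of_bounded hψmeas hψbdd
  set W : ℝ → ℝ := fun x => action f ψ a t x (uPlus f ψ x t) with hW
  have hWmin : ∀ x v, W x ≤ action f ψ a t x v := fun x =>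
    (mem_maxSet_iff hf hconv hψmeas hψbdd ht).1 (uPlus_mem_maxSet hf hconv hdeg hψmeas hψbdd x ht)
  have hWlip := lipschitzWith_of_eq_action hψmeas hψbdd hWmin fun _ => rfl
  -- comparison of `ψ` with either datum
  have key : ∀ (φ : ℝ → ℝ) (M : ℝ), Measurable φ → (∀ x, |φ x| ≤ M) →
      (∀ y, a ≤ y → φ y ≤ ψ y) → (∀ y, y < a → ψ y ≤ φ y) →
      uMinus f φ x₁ t ≤ max (uMinus f φ₁ x₁ t) (uMinus f φ₂ x₁ t) →
      min (uPlus f φ₁ x₂ t) (uPlus f φ₂ x₂ t) ≤ uPlus f φ x₂ t →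
      ∃ V : ℝ → ℝ, LipschitzWith M.toNNReal V ∧
        (∀ x d, HasDerivAt V d x → d = uPlus f φ x t) ∧
        MonotoneOn (fun x => W x - V x) (Ioi x₁) ∧
        a ≤ b ∧ (W x₂ - V x₂) - (W x₁ - V x₁) ≤ ∫ y in a..b, (ψ y - φ y) := by
    intro φ M hm hbd hge hlt hleft hright
    have hφi := intervalIntegrable_of_bounded hm hbd
    set V : ℝ → ℝ := fun x => action f φ a t x (uPlus f φ x t) with hV
    have hVmin : ∀ x v, V x ≤ action f φ a t x v := fun x =>
      (mem_maxSet_iff hf hconv hm hbd ht).1 (uPlus_mem_maxSet hf hconv hdeg hm hbd x ht)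
    have hfoot : ∀ x, x₁ < x → a ≤ x - t * deriv f (uPlus f φ x t) := by
      intro x hxx
      refine le_trans ?_ (foot_le_foot hd hc hmono ht hxx (hVmin x₁) (hVmin x))
      have := hmono.monotone ((uPlus_le_uMinus hf hconv hdeg hm hbd x₁ ht).trans hleft)
      exact sub_le_sub_left (mul_le_mul_of_nonneg_left this ht.le) _
    have hbfoot : x₂ - t * deriv f (uPlus f φ x₂ t) ≤ b :=
      sub_le_sub_left (mul_le_mul_of_nonneg_left (hmono.monotone hright) ht.le) _
    have hdiff : ∀ p q, ∫ y in p..q, (ψ y - φ y) = (∫ y in p..q, ψ y) - ∫ y in p..q, φ y :=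
      fun p q => intervalIntegral.integral_sub (hψi p q) (hφi p q)
    refine ⟨V, lipschitzWith_of_eq_action hm hbd hVmin fun _ => rfl, fun x d hder =>
      eq_of_hasDerivAt_of_le_action hd hc hmono ht hVmin rfl hder, ?_,
      (hfoot x₂ hx).trans hbfoot, ?_⟩
    · intro x hxm x' _ hxx'
      rcases hxx'.eq_or_lt with rfl | hlt'
      · rfl
      have := action_add_le_action_add hd hc hmono (u' := uPlus f ψ x' t) ht hlt' hφi hψi hge
        (hfoot x hxm) (hVmin x') (hWmin x)
      simp only [hW, hV]
      linarith
    · have h1 : W x₂ - V x₂ ≤ ∫ y in a..b, (ψ y - φ y) := by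
        have h := hWmin x₂ (uPlus f φ x₂ t)
        have h2 : ∫ y in a..(x₂ - t * deriv f (uPlus f φ x₂ t)), (ψ y - φ y) ≤
            ∫ y in a..b, (ψ y - φ y) := by
          rw [← intervalIntegral.integral_add_adjacent_intervals (c := b)
            ((hψi a (x₂ - t * deriv f (uPlus f φ x₂ t))).sub (hφi _ _))
            ((hψi _ _).sub (hφi _ _))]
          exact le_add_of_nonneg_right (intervalIntegral.integral_nonneg hbfoot fun y hy =>
            sub_nonneg.2 (hge y ((hfoot x₂ hx).trans hy.1)))
        rw [hdiff] at h2
        simp only [hV, action] at h ⊢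
        linarith
      have h3 : 0 ≤ W x₁ - V x₁ := by
        have h := hVmin x₁ (uPlus f ψ x₁ t)
        have h4 : 0 ≤ ∫ y in a..(x₁ - t * deriv f (uPlus f ψ x₁ t)), (ψ y - φ y) := by
          rcases le_total a (x₁ - t * deriv f (uPlus f ψ x₁ t)) with hy | hy
          · exact intervalIntegral.integral_nonneg hy fun y hy => sub_nonneg.2 (hge y hy.1)
          · rw [intervalIntegral.integral_symm, hdiff, neg_sub, sub_nonneg]
            exact intervalIntegral.integral_mono_on_of_le_Ioo hy (hψi _ _) (hφi _ _)
              fun y hy => hlt y hy.2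
        rw [hdiff] at h4
        simp only [hW, action] at h ⊢
        linarith
      linarith
  obtain ⟨V₁, hlip₁, hder₁, hmono₁, hab, hinc₁⟩ := key φ₁ M₁ hφ₁meas hφ₁bdd
    (fun y hy => (le_max_left _ _).trans (hψ_ge y hy).ge)
    (fun y hy => (hψ_lt y hy).le.trans (min_le_left _ _)) (le_max_left _ _) (min_le_left _ _)
  obtain ⟨V₂, hlip₂, hder₂, hmono₂, -, hinc₂⟩ := key φ₂ M₂ hφ₂meas hφ₂bdd
    (fun y hy => (le_max_right _ _).trans (hψ_ge y hy).ge)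
    (fun y hy => (hψ_lt y hy).le.trans (min_le_right _ _)) (le_max_right _ _) (min_le_right _ _)
  have hφ₁i := intervalIntegrable_of_bounded hφ₁meas hφ₁bdd
  have hφ₂i := intervalIntegrable_of_bounded hφ₂meas hφ₂bdd
  set P : ℝ → ℝ := fun x => (W x - V₁ x) + (W x - V₂ x) with hP
  have hPac : AbsolutelyContinuousOnInterval P x₁ x₂ :=
    ((hWlip.sub hlip₁).add (hWlip.sub hlip₂)).lipschitzOnWith.absolutelyContinuousOnInterval
  have hae : ∀ᵐ x, x ∈ Ioc x₁ x₂ → |uPlus f φ₂ x t - uPlus f φ₁ x t| ≤ deriv P x := by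
    filter_upwards [hWlip.ae_differentiableAt_of_real, hlip₁.ae_differentiableAt_of_real,
      hlip₂.ae_differentiableAt_of_real] with x hWx hV₁x hV₂x hxm
    have hD₁ := hWx.hasDerivAt.fun_sub hV₁x.hasDerivAt
    have hD₂ := hWx.hasDerivAt.fun_sub hV₂x.hasDerivAt
    have hn : Ioi x₁ ∈ nhds x := Ioi_mem_nhds hxm.1
    have h1 : 0 ≤ deriv W x - deriv V₁ x := by
      have := hmono₁.derivWithin_nonneg (x := x)
      rwa [derivWithin_of_mem_nhds hn, HasDerivAt.deriv hD₁] at this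
    have h2 : 0 ≤ deriv W x - deriv V₂ x := by
      have := hmono₂.derivWithin_nonneg (x := x)
      rwa [derivWithin_of_mem_nhds hn, HasDerivAt.deriv hD₂] at this
    rw [(hD₁.fun_add hD₂).deriv, ← hder₁ x _ hV₁x.hasDerivAt, ← hder₂ x _ hV₂x.hasDerivAt, abs_le]
    constructor <;> linarith
  calc ∫ x in x₁..x₂, |uPlus f φ₂ x t - uPlus f φ₁ x t|
      ≤ ∫ x in x₁..x₂, deriv P x := by
        rw [intervalIntegral.integral_of_le hx.le, intervalIntegral.integral_of_le hx.le]
        exact integral_mono_of_nonneg (Eventually.of_forall fun _ => abs_nonneg _)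
          hPac.intervalIntegrable_deriv.1 ((ae_restrict_iff' measurableSet_Ioc).2 hae)
    _ = P x₂ - P x₁ := hPac.integral_deriv_eq_sub
    _ ≤ (∫ y in a..b, (ψ y - φ₁ y)) + ∫ y in a..b, (ψ y - φ₂ y) := by
        simp only [hP]
        linarith
    _ = ∫ y in a..b, |φ₂ y - φ₁ y| := by
        rw [← intervalIntegral.integral_add ((hψi _ _).sub (hφ₁i _ _)) ((hψi _ _).sub (hφ₂i _ _))]
        refine intervalIntegral.integral_congr fun y hy => ?_
        rw [uIcc_of_le hab] at hy
        simp only [hψ_ge y hy.1]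
        rcases le_total (φ₁ y) (φ₂ y) with h | h
        · rw [max_eq_right h, abs_of_nonneg (sub_nonneg.2 h)]; ring
        · rw [max_eq_left h, abs_of_nonpos (sub_nonpos.2 h)]; ring
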